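/- arXiv:2305.15835 — 2 statements merged into one kernel-verified Lean document; each statement's English description precedes it below -/
import Mathlib

section
/- Let (Z, 𝒜) be a measurable space with probability measure μ, let P₁, …, P_K be a measurable partition of Z, and let ℓ : Z → ℝ be measurable with 0 ≤ ℓ(z) ≤ M for all z. Let z₁, …, z_N ∈ Z be points, and for each i let N_i = #{ j ≤ N : z_j ∈ P_i }. Suppose ε₀ ≥ 0 is such that |ℓ(z) − ℓ(z′)| ≤ ε₀ whenever z and z′ lie in the same partition cell P_i. Then | ∫_Z ℓ dμ − (1/N) ∑_{j=1}^N ℓ(z_j) | ≤ ε₀ + M · ∑_{i=1}^K | N_i/N − μ(P_i) |. -/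
open MeasureTheory

/-- A function with values in `[0, M]` and oscillation at most `ε` on `s` is within `ε / 2` of a
constant of `[0, M]` on `s`. -/
lemma exists_midpoint_of_oscillation_le {α : Type*} {f : α → ℝ} {s : Set α} {M ε : ℝ}
    (hM : 0 ≤ M) (h0 : ∀ a, 0 ≤ f a) (h1 : ∀ a, f a ≤ M)
    (h : ∀ a ∈ s, ∀ b ∈ s, |f a - f b| ≤ ε) :
    ∃ c, 0 ≤ c ∧ c ≤ M ∧ ∀ a ∈ s, |f a - c| ≤ ε / 2 := by
  rcases s.eq_empty_or_nonempty with rfl | hs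
  · exact ⟨0, le_rfl, hM, by simp⟩
  have hne : (f '' s).Nonempty := hs.image f
  have hA : BddAbove (f '' s) := ⟨M, by rintro _ ⟨a, -, rfl⟩; exact h1 a⟩
  have hB : BddBelow (f '' s) := ⟨0, by rintro _ ⟨a, -, rfl⟩; exact h0 a⟩
  have hle : sSup (f '' s) ≤ sInf (f '' s) + ε := by
    refine csSup_le hne ?_
    rintro _ ⟨a, ha, rfl⟩
    suffices f a - ε ≤ sInf (f '' s) by linarith
    refine le_csInf hne ?_
    rintro _ ⟨b, hb, rfl⟩
    linarith [(abs_le.1 (h a ha b hb)).2]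
  have hI : 0 ≤ sInf (f '' s) := le_csInf hne (by rintro _ ⟨a, -, rfl⟩; exact h0 a)
  have hS : sSup (f '' s) ≤ M := csSup_le hne (by rintro _ ⟨a, -, rfl⟩; exact h1 a)
  have hIS : sInf (f '' s) ≤ sSup (f '' s) := csInf_le_csSup hne hB hA
  refine ⟨(sInf (f '' s) + sSup (f '' s)) / 2, by linarith, by linarith, fun a ha ↦ ?_⟩
  have ha1 := le_csSup hA (Set.mem_image_of_mem f ha)
  have ha2 := csInf_le hB (Set.mem_image_of_mem f ha)
  rw [abs_le]
  constructor <;> linarith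

/-- Deterministic robustness decomposition: if the loss `ℓ` (bounded by `M`) varies by at
most `ε₀` within each cell of a measurable partition `P₁, …, P_K`, then the generalization
error is bounded by `ε₀` plus `M` times the total variation between empirical cell
frequencies and true cell probabilities. -/
theorem robustness_decomposition {Z : Type*} [MeasurableSpace Z]
    (μ : Measure Z) [IsProbabilityMeasure μ]
    (K : ℕ) (P : Fin K → Set Z)
    (hPmeas : ∀ i, MeasurableSet (P i))
    (hPdisj : Pairwise (Function.onFun Disjoint P))
    (hPcover : (⋃ i, P i) = Set.univ)
    (M : ℝ) (ℓ : Z → ℝ) (hℓmeas : Measurable ℓ)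
    (hℓ0 : ∀ z, 0 ≤ ℓ z) (hℓM : ∀ z, ℓ z ≤ M)
    (N : ℕ) (hN : 0 < N) (z : Fin N → Z)
    (ε₀ : ℝ) (hε₀ : 0 ≤ ε₀)
    (hrobust : ∀ i, ∀ a ∈ P i, ∀ b ∈ P i, |ℓ a - ℓ b| ≤ ε₀) :
    |(∫ w, ℓ w ∂μ) - (1 / N) * ∑ j, ℓ (z j)|
      ≤ ε₀ + M * ∑ i, |(({j | z j ∈ P i} : Set (Fin N)).ncard : ℝ) / N - (μ (P i)).toReal| := by
  have hM : 0 ≤ M := (hℓ0 (z ⟨0, hN⟩)).trans (hℓM _)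
  have hN' : (0 : ℝ) < N := Nat.cast_pos.2 hN
  choose c hc0 hcM hc using fun i ↦
    exists_midpoint_of_oscillation_le hM hℓ0 hℓM (hrobust i)
  let g : Z → ℝ := fun w ↦ ∑ i, (P i).indicator (fun _ ↦ c i) w
  have hg : ∀ w, |ℓ w - g w| ≤ ε₀ / 2 := by
    intro w
    obtain ⟨i, hi⟩ := Set.mem_iUnion.1 (hPcover ▸ Set.mem_univ w)
    have hgw : g w = c i := by
      refine (Finset.sum_eq_single i (fun k _ hk ↦ ?_) (by simp)).trans
        (Set.indicator_of_mem hi _)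
      exact Set.indicator_of_notMem (fun hk' ↦ (hPdisj hk).le_bot ⟨hk', hi⟩) _
    rw [hgw]
    exact hc i w hi
  have hind : ∀ i, Integrable ((P i).indicator (fun _ ↦ c i)) μ := fun i ↦
    (integrable_const (c i)).indicator (hPmeas i)
  have hgint : Integrable g μ := integrable_finsetSum _ fun i _ ↦ hind i
  have hℓint : Integrable ℓ μ :=
    Integrable.of_bound hℓmeas.aestronglyMeasurable M
      (ae_of_all _ fun w ↦ by rw [Real.norm_of_nonneg (hℓ0 w)]; exact hℓM w)
  have hrisk : |(∫ w, ℓ w ∂μ) - ∑ i, (μ (P i)).toReal * c i| ≤ ε₀ / 2 := by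
    have hgI : ∫ w, g w ∂μ = ∑ i, (μ (P i)).toReal * c i := by
      rw [integral_finsetSum _ fun i _ ↦ hind i]
      refine Finset.sum_congr rfl fun i _ ↦ ?_
      rw [integral_indicator_const _ (hPmeas i), smul_eq_mul, measureReal_def]
    rw [← hgI, ← integral_sub hℓint hgint, ← Real.norm_eq_abs]
    simpa using norm_integral_le_of_norm_le_const (μ := μ) (f := fun w ↦ ℓ w - g w)
      (ae_of_all _ hg)
  have hemp : |(1 / N) * ∑ j, ℓ (z j) -
      ∑ i, (({j | z j ∈ P i} : Set (Fin N)).ncard : ℝ) / N * c i| ≤ ε₀ / 2 := by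
    have hgS : ∑ i, (({j | z j ∈ P i} : Set (Fin N)).ncard : ℝ) / N * c i =
        (1 / N) * ∑ j, g (z j) := by
      classical
      rw [Finset.sum_comm, Finset.mul_sum]
      refine Finset.sum_congr rfl fun i _ ↦ ?_
      simp only [Set.indicator_apply, ← Finset.sum_filter, Finset.sum_const, nsmul_eq_mul]
      rw [← Set.ncard_coe_finset, Finset.coe_filter_univ]
      ring
    rw [hgS, ← mul_sub, ← Finset.sum_sub_distrib, abs_mul, abs_of_pos (by positivity),
      one_div, inv_mul_le_iff₀ hN']
    calc |∑ j, (ℓ (z j) - g (z j))| ≤ ∑ j, |ℓ (z j) - g (z j)| := Finset.abs_sum_le_sum_abs _ _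
      _ ≤ ∑ _j : Fin N, ε₀ / 2 := Finset.sum_le_sum fun j _ ↦ hg _
      _ = N * (ε₀ / 2) := by simp
  have hfreq : |∑ i, (({j | z j ∈ P i} : Set (Fin N)).ncard : ℝ) / N * c i -
      ∑ i, (μ (P i)).toReal * c i| ≤
      M * ∑ i, |(({j | z j ∈ P i} : Set (Fin N)).ncard : ℝ) / N - (μ (P i)).toReal| := by
    rw [← Finset.sum_sub_distrib, Finset.mul_sum]
    refine (Finset.abs_sum_le_sum_abs _ _).trans (Finset.sum_le_sum fun i _ ↦ ?_)
    rw [← sub_mul, abs_mul, abs_of_nonneg (hc0 i), mul_comm]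
    exact mul_le_mul_of_nonneg_right (hcM i) (abs_nonneg _)
  rw [abs_le] at hrisk hemp hfreq ⊢
  constructor <;> linarith
end

section
/- (Breteganolle–Huber–Carol inequality.) Let (Z, 𝒜) be a measurable space with probability measure μ, let P₁, …, P_K be a measurable partition of Z, and let N ≥ 1. For a sample s = (z₁, …, z_N) ∈ Z^N, let N_i(s) = #{ j ≤ N : z_j ∈ P_i }. Then for every ε ∈ (0,1), with probability at least 1 − ε over s drawn from the N-fold product measure μ^{⊗N} on Z^N, one has ∑_{i=1}^K | N_i(s)/N − μ(P_i) | ≤ √( (2K·ln 2 + 2·ln(1/ε)) / N ). Equivalently, for every λ > 0, μ^{⊗N}{ s : ∑_{i=1}^K | N_i(s)/N − μ(P_i) | ≥ λ } ≤ 2^K · exp(−N λ² / 2). -/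
open MeasureTheory ProbabilityTheory

/-- Hoeffding's inequality for the sum over an i.i.d. sample of a function with values in
`[-1, 1]`. -/
theorem measure_pi_sum_sub_integral_ge_le {Z : Type*} [MeasurableSpace Z]
    (μ : Measure Z) [IsProbabilityMeasure μ] {f : Z → ℝ} (hf : Measurable f)
    (hb : ∀ z, f z ∈ Set.Icc (-1 : ℝ) 1) (N : ℕ) {t : ℝ} (ht : 0 ≤ t) :
    (Measure.pi fun _ : Fin N => μ) {s | t ≤ ∑ j, (f (s j) - ∫ z, f z ∂μ)}
      ≤ ENNReal.ofReal (Real.exp (-t ^ 2 / (2 * N))) := by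
  have hsub : HasSubgaussianMGF (fun z => f z - ∫ z, f z ∂μ) 1 μ := by
    have h := hasSubgaussianMGF_of_mem_Icc (μ := μ) hf.aemeasurable (ae_of_all _ hb)
    convert h using 1
    ext
    norm_num
  have hind : iIndepFun (fun (j : Fin N) (s : Fin N → Z) => f (s j) - ∫ z, f z ∂μ)
      (Measure.pi fun _ : Fin N => μ) :=
    iIndepFun_pi (X := fun _ z => f z - ∫ z, f z ∂μ)
      fun _ => (hf.sub_const _).aemeasurable
  have hsubj : ∀ j ∈ (Finset.univ : Finset (Fin N)),
      HasSubgaussianMGF (fun s : Fin N → Z => f (s j) - ∫ z, f z ∂μ) 1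
        (Measure.pi fun _ : Fin N => μ) := by
    intro j _
    have hmp := measurePreserving_eval (fun _ : Fin N => μ) j
    refine HasSubgaussianMGF.of_map (Y := fun s : Fin N → Z => s j)
      (X := fun z => f z - ∫ z, f z ∂μ) hmp.measurable.aemeasurable ?_
    have hmap : (Measure.pi fun _ : Fin N => μ).map (fun s => s j) = μ := hmp.map_eq
    rwa [hmap]
  have h := HasSubgaussianMGF.measure_sum_ge_le_of_iIndepFun hind hsubj ht
  rw [← ofReal_measureReal]
  refine ENNReal.ofReal_le_ofReal (h.trans_eq ?_)
  simp

/-- The absolute values of a finite family sum to some signed sum of the family. -/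
theorem exists_finset_sum_abs_eq {ι : Type*} [Fintype ι] [DecidableEq ι] (d : ι → ℝ) :
    ∃ A : Finset ι, ∑ i, |d i| = ∑ i, (if i ∈ A then 1 else -1) * d i := by
  classical
  refine ⟨Finset.univ.filter fun i => 0 ≤ d i, Finset.sum_congr rfl fun i _ => ?_⟩
  by_cases h : 0 ≤ d i
  · simp [h, abs_of_nonneg h]
  · simp [h, abs_of_neg (not_le.mp h)]

/-- A signed sum of the indicators of a partition takes values in `[-1, 1]`. -/
theorem sum_sign_mul_indicator_mem_Icc {Z ι : Type*} [Fintype ι] [DecidableEq ι] {P : ι → Set Z}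
    (hPdisj : Pairwise (Function.onFun Disjoint P)) (hPcover : (⋃ i, P i) = Set.univ)
    (A : Finset ι) (z : Z) :
    ∑ i, (if i ∈ A then (1 : ℝ) else -1) * (P i).indicator 1 z ∈ Set.Icc (-1 : ℝ) 1 := by
  obtain ⟨k, hk⟩ := Set.mem_iUnion.mp (hPcover ▸ Set.mem_univ z)
  rw [Finset.sum_eq_single k]
  · split_ifs <;> simp [hk]
  · intro i _ hik
    simp [Set.disjoint_right.mp (hPdisj hik) hk]
  · simp

/-- The number of sample points in a set is the sum of its indicator over the sample. -/
theorem ncard_setOf_mem_eq_sum_indicator {Z : Type*} {N : ℕ} (S : Set Z) (s : Fin N → Z) :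
    (({j | s j ∈ S} : Set (Fin N)).ncard : ℝ) = ∑ j, S.indicator 1 (s j) := by
  classical
  rw [Set.ncard_eq_toFinset_card']
  simp [Set.indicator_apply]

/-- Tail bound for the `ℓ¹` distance between the empirical cell frequencies and the cell
probabilities of a partition. -/
theorem measure_pi_sum_abs_frequency_sub_ge_le {Z : Type*} [MeasurableSpace Z]
    (μ : Measure Z) [IsProbabilityMeasure μ]
    (K : ℕ) (P : Fin K → Set Z)
    (hPmeas : ∀ i, MeasurableSet (P i))
    (hPdisj : Pairwise (Function.onFun Disjoint P))
    (hPcover : (⋃ i, P i) = Set.univ)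
    (N : ℕ) (hN : 1 ≤ N) (lam : ℝ) (hlam : 0 < lam) :
    (Measure.pi fun _ : Fin N => μ)
        {s : Fin N → Z |
          lam ≤ ∑ i, |(({j | s j ∈ P i} : Set (Fin N)).ncard : ℝ) / N - (μ (P i)).toReal|}
      ≤ ENNReal.ofReal (2 ^ K * Real.exp (-(N * lam ^ 2) / 2)) := by
  have hN0 : (0 : ℝ) < N := by exact_mod_cast hN
  let f : Finset (Fin K) → Z → ℝ := fun A z =>
    ∑ i, (if i ∈ A then (1 : ℝ) else -1) * (P i).indicator 1 z
  have hf : ∀ A, Measurable (f A) := fun A =>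
    Finset.measurable_sum _ fun i _ => (measurable_one.indicator (hPmeas i)).const_mul _
  have hint : ∀ A, ∫ z, f A z ∂μ = ∑ i, (if i ∈ A then (1 : ℝ) else -1) * (μ (P i)).toReal := by
    intro A
    have hi : ∀ i ∈ Finset.univ, Integrable
        (fun z => (if i ∈ A then (1 : ℝ) else -1) * (P i).indicator 1 z) μ := fun i _ =>
      ((integrable_const (1 : ℝ)).indicator (hPmeas i)).const_mul _
    rw [integral_finsetSum _ hi]
    refine Finset.sum_congr rfl fun i _ => ?_
    rw [integral_const_mul, integral_indicator_one (hPmeas i), Measure.real]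
  have hsum : ∀ A (s : Fin N → Z), ∑ j, (f A (s j) - ∫ z, f A z ∂μ) =
      N * ∑ i, (if i ∈ A then (1 : ℝ) else -1) *
        ((({j | s j ∈ P i} : Set (Fin N)).ncard : ℝ) / N - (μ (P i)).toReal) := by
    intro A s
    simp only [Finset.sum_sub_distrib, Finset.sum_const, Finset.card_univ, Fintype.card_fin,
      nsmul_eq_mul, hint, f]
    rw [Finset.sum_comm]
    simp only [← Finset.mul_sum, ← ncard_setOf_mem_eq_sum_indicator]
    simp only [Finset.mul_sum]
    rw [← Finset.sum_sub_distrib]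
    refine Finset.sum_congr rfl fun i _ => ?_
    field_simp
  calc _ ≤ (Measure.pi fun _ : Fin N => μ)
        (⋃ A : Finset (Fin K), {s | N * lam ≤ ∑ j, (f A (s j) - ∫ z, f A z ∂μ)}) := by
        refine measure_mono fun s hs => ?_
        obtain ⟨A, hA⟩ := exists_finset_sum_abs_eq fun i =>
          (({j | s j ∈ P i} : Set (Fin N)).ncard : ℝ) / N - (μ (P i)).toReal
        refine Set.mem_iUnion.mpr ⟨A, ?_⟩
        rw [Set.mem_ofPred_eq, hA] at hs
        rw [Set.mem_ofPred_eq, hsum]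
        exact mul_le_mul_of_nonneg_left hs hN0.le
    _ ≤ ∑ A : Finset (Fin K), (Measure.pi fun _ : Fin N => μ)
        {s | N * lam ≤ ∑ j, (f A (s j) - ∫ z, f A z ∂μ)} := measure_iUnion_fintype_le _ _
    _ ≤ ∑ _A : Finset (Fin K), ENNReal.ofReal (Real.exp (-(N * lam) ^ 2 / (2 * N))) :=
        Finset.sum_le_sum fun A _ => measure_pi_sum_sub_integral_ge_le μ (hf A)
          (sum_sign_mul_indicator_mem_Icc hPdisj hPcover A) N (by positivity)
    _ = ENNReal.ofReal (2 ^ K * Real.exp (-(N * lam ^ 2) / 2)) := by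
        have he : -(N * lam) ^ 2 / (2 * N) = -(N * lam ^ 2) / 2 := by field_simp
        rw [he, ENNReal.ofReal_mul (by positivity)]
        simp [ENNReal.ofReal_pow]

/-- Breteganolle–Huber–Carol inequality: concentration of the empirical cell frequencies
of a measurable partition `P₁, …, P_K` around the true cell probabilities, for `N`
independent samples drawn from `μ`; stated in both the "probability at least `1 - ε`"
form and the equivalent tail-bound form. -/
theorem breteganolle_huber_carol {Z : Type*} [MeasurableSpace Z]
    (μ : Measure Z) [IsProbabilityMeasure μ]
    (K : ℕ) (P : Fin K → Set Z)
    (hPmeas : ∀ i, MeasurableSet (P i))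
    (hPdisj : Pairwise (Function.onFun Disjoint P))
    (hPcover : (⋃ i, P i) = Set.univ)
    (N : ℕ) (hN : 1 ≤ N) :
    (∀ ε : ℝ, ε ∈ Set.Ioo (0 : ℝ) 1 →
      ENNReal.ofReal (1 - ε) ≤
        (Measure.pi fun _ : Fin N => μ)
          {s : Fin N → Z |
            ∑ i, |(({j | s j ∈ P i} : Set (Fin N)).ncard : ℝ) / N - (μ (P i)).toReal|
              ≤ Real.sqrt ((2 * K * Real.log 2 + 2 * Real.log (1 / ε)) / N)})
    ∧ (∀ lam : ℝ, 0 < lam →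
      (Measure.pi fun _ : Fin N => μ)
          {s : Fin N → Z |
            lam ≤ ∑ i, |(({j | s j ∈ P i} : Set (Fin N)).ncard : ℝ) / N - (μ (P i)).toReal|}
        ≤ ENNReal.ofReal (2 ^ K * Real.exp (-(N * lam ^ 2) / 2))) := by
  have htail := measure_pi_sum_abs_frequency_sub_ge_le μ K P hPmeas hPdisj hPcover N hN
  refine ⟨fun ε hε => ?_, htail⟩
  obtain ⟨hε0, hε1⟩ := hε
  have hN0 : (0 : ℝ) < N := by exact_mod_cast hN
  have hlog : 0 < Real.log (1 / ε) := Real.log_pos (one_lt_one_div hε0 hε1)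
  have hpos : 0 < (2 * K * Real.log 2 + 2 * Real.log (1 / ε)) / N := by positivity
  have ht := htail _ (Real.sqrt_pos.mpr hpos)
  have heq : (2 : ℝ) ^ K * Real.exp
      (-(N * Real.sqrt ((2 * K * Real.log 2 + 2 * Real.log (1 / ε)) / N) ^ 2) / 2) = ε := by
    rw [Real.sq_sqrt hpos.le, mul_div_cancel₀ _ hN0.ne', one_div, Real.log_inv,
      show -(2 * K * Real.log 2 + 2 * -Real.log ε) / 2 = -(K * Real.log 2) + Real.log ε by ring,
      Real.exp_add, Real.exp_log hε0, Real.exp_neg, Real.exp_nat_mul,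
      Real.exp_log (by norm_num)]
    field_simp
  rw [heq] at ht
  rw [ENNReal.ofReal_sub _ hε0.le, ENNReal.ofReal_one, tsub_le_iff_right]
  refine le_trans ?_ (add_le_add le_rfl ht)
  rw [← measure_univ (μ := Measure.pi fun _ : Fin N => μ)]
  refine (measure_mono fun s _ => ?_).trans (measure_union_le _ _)
  rw [Set.mem_union, Set.mem_ofPred_eq, Set.mem_ofPred_eq]
  exact le_total _ _
end
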